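/- Let d ≥ 1 and let M be a nonnegative 2^d × 2^d matrix, with rows and columns indexed by {0,1}^d, that admits an S^d_+-factorization and satisfies M_{a,b} = 0 whenever aᵀb = 1. Then M has at least one zero entry on the antidiagonal: there exists a ∈ {0,1}^d such that M_{a,ā} = 0, where ā denotes the bitwise complement of a. -/

import Mathlib

/-- Bit strings of length `n`. -/
abbrev BitStr (n : ℕ) : Type := Fin n → Bool

/-- The inner product `aᵀb = Σᵢ aᵢbᵢ` of two bit strings (a natural number;
its value over `ℝ` is obtained by coercion). -/
def bitIP {n : ℕ} (a b : BitStr n) : ℕ := ∑ i, if a i && b i then 1 else 0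

/-- `val M`: the number of pairs `(a,b) ∈ {0,1}ⁿ × {0,1}ⁿ` with `aᵀb = 0` and `M a b > 0`. -/
noncomputable def valM {n : ℕ} (M : Matrix (BitStr n) (BitStr n) ℝ) : ℕ :=
  (Finset.univ.filter fun p : BitStr n × BitStr n =>
    bitIP p.1 p.2 = 0 ∧ 0 < M p.1 p.2).card

/-- `M` admits an `S^d_+`-factorization: `M a b = Tr(X_a Y_b)` for `d × d` real
positive semidefinite matrices `X_a` (one per row) and `Y_b` (one per column). -/
def HasPsdFactorization (d : ℕ) {n : ℕ} (M : Matrix (BitStr n) (BitStr n) ℝ) : Prop :=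
  ∃ (X Y : BitStr n → Matrix (Fin d) (Fin d) ℝ),
    (∀ a, (X a).PosSemidef) ∧ (∀ b, (Y b).PosSemidef) ∧
    ∀ a b, M a b = (X a * Y b).trace

/-- The set `A_{S^d_+}(n)` of nonnegative `2^n × 2^n` matrices admitting an
`S^d_+`-factorization and vanishing on all pairs with `aᵀb = 1`. -/
def AtomsPsd (d n : ℕ) : Set (Matrix (BitStr n) (BitStr n) ℝ) :=
  {M | (∀ a b, 0 ≤ M a b) ∧ HasPsdFactorization d M ∧
    ∀ a b, bitIP a b = 1 → M a b = 0}

/-- A rectangle: a set of pairs of the form `I × J`. -/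
def IsRectangle {d : ℕ} (R : Finset (BitStr d × BitStr d)) : Prop :=
  ∃ I J : Finset (BitStr d), R = I ×ˢ J

/-- The rectangles `R 0, …, R (k-1)` witness a `k`-uniform-covering of the set `S`:
each `R i` is a rectangle supported on the disjoint pairs, and for every `M ∈ S`
there is an injective map `φ` sending each disjoint pair on which `M` is positive
to (the index of) a rectangle containing that pair. -/
def UniformCoveringWith {d : ℕ} (S : Set (Matrix (BitStr d) (BitStr d) ℝ)) {k : ℕ}
    (R : Fin k → Finset (BitStr d × BitStr d)) : Prop :=
  (∀ i, IsRectangle (R i)) ∧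
  (∀ i, ∀ p ∈ R i, bitIP p.1 p.2 = 0) ∧
  ∀ M ∈ S, ∃ φ : {p : BitStr d × BitStr d // bitIP p.1 p.2 = 0 ∧ 0 < M p.1 p.2} → Fin k,
    Function.Injective φ ∧ ∀ p, (p : BitStr d × BitStr d) ∈ R (φ p)

/-- The set `S` of `2^d × 2^d` nonnegative matrices has a `k`-uniform-covering. -/
def HasUniformCovering {d : ℕ} (S : Set (Matrix (BitStr d) (BitStr d) ℝ)) (k : ℕ) : Prop :=
  ∃ R : Fin k → Finset (BitStr d × BitStr d), UniformCoveringWith S R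

open Matrix MatrixOrder in
theorem Matrix.PosSemidef.mul_eq_zero_of_trace_mul_eq_zero {m : Type*} [Fintype m]
    {A B : Matrix m m ℝ} (hA : A.PosSemidef) (hB : B.PosSemidef)
    (h : (A * B).trace = 0) : A * B = 0 := by
  classical
  obtain ⟨C, rfl⟩ := CStarAlgebra.nonneg_iff_eq_star_mul_self.mp hA.nonneg
  obtain ⟨D, rfl⟩ := CStarAlgebra.nonneg_iff_eq_star_mul_self.mp hB.nonneg
  rw [star_eq_conjTranspose, star_eq_conjTranspose] at *
  have hCD : C * Dᴴ = 0 := by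
    rw [← trace_mul_conjTranspose_self_eq_zero_iff, ← h, conjTranspose_mul,
      conjTranspose_conjTranspose, trace_mul_comm (Cᴴ * C), Matrix.mul_assoc, trace_mul_comm C]
    simp only [Matrix.mul_assoc]
  rw [Matrix.mul_assoc, ← Matrix.mul_assoc C, hCD, Matrix.zero_mul, Matrix.mul_zero]

theorem bitIP_cons {n : ℕ} (x y : Bool) (a b : BitStr n) :
    bitIP (Fin.cons x a : BitStr (n + 1)) (Fin.cons y b : BitStr (n + 1)) =
      (if x && y then 1 else 0) + bitIP a b := by
  unfold bitIP
  rw [Fin.sum_univ_succ]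
  simp only [Fin.cons_zero, Fin.cons_succ]

/-- A family of positive semidefinite matrices whose row factors have their ranges in a subspace of
dimension at most `n` obeys the antidiagonal sparsity lemma on `{0,1}ⁿ`. -/
theorem exists_trace_mul_compl_eq_zero {m : Type*} [Fintype m] (n : ℕ)
    (X Y : BitStr n → Matrix m m ℝ) (hX : ∀ a, (X a).PosSemidef) (hY : ∀ b, (Y b).PosSemidef)
    (K : Submodule ℝ (m → ℝ)) (hK : Module.finrank ℝ K ≤ n)
    (hXK : ∀ a, LinearMap.range (X a).mulVecLin ≤ K)
    (hzero : ∀ a b, bitIP a b = 1 → (X a * Y b).trace = 0) :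
    ∃ a : BitStr n, (X a * Y (fun i => !(a i))).trace = 0 := by
  classical
  have mul_eq_zero_iff (A B : Matrix m m ℝ) :
      A * B = 0 ↔ LinearMap.range B.mulVecLin ≤ LinearMap.ker A.mulVecLin := by
    rw [LinearMap.range_le_ker_iff, ← Matrix.mulVecLin_mul]
    exact ⟨fun h => by rw [h, Matrix.mulVecLin_zero],
      fun h => Matrix.mulVec_injective (congrArg DFunLike.coe (h.trans Matrix.mulVecLin_zero.symm))⟩
  induction n generalizing K with
  | zero =>
    have hbot : K = ⊥ := Submodule.finrank_eq_zero.mp (Nat.le_zero.mp hK)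
    have h0 : (Y fun _ => true) * X (fun _ => true) = 0 :=
      (mul_eq_zero_iff _ _).mpr ((hXK _).trans (hbot ▸ bot_le))
    refine ⟨fun _ => true, ?_⟩
    rw [Matrix.trace_mul_comm, Subsingleton.elim (fun i : Fin 0 => !true) (fun _ => true), h0,
      Matrix.trace_zero]
  | succ n ih =>
    let e : BitStr (n + 1) := Fin.cons true fun _ => false
    by_cases hle : K ≤ LinearMap.ker (Y e).mulVecLin
    · refine ⟨fun i => !(e i), ?_⟩
      simp only [Bool.not_not]
      rw [Matrix.trace_mul_comm, (mul_eq_zero_iff _ _).mpr ((hXK _).trans hle), Matrix.trace_zero]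
    have hlt : K ⊓ LinearMap.ker (Y e).mulVecLin < K :=
      lt_of_le_of_ne inf_le_left fun h => hle (inf_eq_left.mp h)
    obtain ⟨a, ha⟩ := ih (fun a => X (Fin.cons true a)) (fun b => Y (Fin.cons false b))
      (fun a => hX _) (fun b => hY _) (K ⊓ LinearMap.ker (Y e).mulVecLin)
      (by have := Submodule.finrank_lt_finrank_of_lt hlt; omega)
      (fun a => le_inf (hXK _) ((mul_eq_zero_iff _ _).mp
        ((hY _).mul_eq_zero_of_trace_mul_eq_zero (hX _) (by
          rw [Matrix.trace_mul_comm]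
          exact hzero _ _ (by rw [bitIP_cons]; simp [bitIP])))))
      (fun a b h => hzero _ _ (by rw [bitIP_cons]; simpa using h))
    refine ⟨Fin.cons true a, ?_⟩
    convert ha using 4
    funext i
    cases i using Fin.cases <;> simp

/-- **Antidiagonal sparsity lemma.** Let `d ≥ 1` and let `M` be a nonnegative
`2^d × 2^d` matrix admitting an `S^d_+`-factorization with `M a b = 0` whenever
`aᵀb = 1`. Then `M` has a zero entry on the antidiagonal: `M a ā = 0` for some
`a ∈ {0,1}^d`, where `ā` is the bitwise complement of `a`. -/
theorem antidiagonal_zero_of_psd_factorization (d : ℕ) (hd : 1 ≤ d)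
    (M : Matrix (BitStr d) (BitStr d) ℝ)
    (hnonneg : ∀ a b, 0 ≤ M a b)
    (hfact : HasPsdFactorization d M)
    (hzero : ∀ a b, bitIP a b = 1 → M a b = 0) :
    ∃ a : BitStr d, M a (fun i => !(a i)) = 0 := by
  obtain ⟨X, Y, hX, hY, hM⟩ := hfact
  obtain ⟨a, ha⟩ := exists_trace_mul_compl_eq_zero d X Y hX hY ⊤ (by simp) (fun _ => le_top)
    fun a b h => hM a b ▸ hzero a b h
  exact ⟨a, (hM _ _).trans ha⟩
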